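/- arXiv:1311.1670 — 2 statements merged into one kernel-verified Lean document; each statement's English description precedes it below -/
import Mathlib

section
/- Let A be a 2×2 matrix with integer entries, let Δ := det A > 0 and τ := Tr A, and suppose 0 < τ² < 4Δ and τ² ∉ {Δ, 2Δ, 3Δ}. Let θ := arccos(τ/(2√Δ)). Then θ/π is irrational. -/
open Matrix

/-- For a `2 × 2` integer matrix `A` with `Δ := det A > 0`, `τ := Tr A`,
`0 < τ² < 4Δ` and `τ² ∉ {Δ, 2Δ, 3Δ}`, the angle `θ := arccos(τ/(2√Δ))` satisfies `θ/π ∉ ℚ`. -/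
theorem rotation_angle_irrational (A : Matrix (Fin 2) (Fin 2) ℤ)
    (hΔ : 0 < A.det) (hτ0 : 0 < (A.trace) ^ 2) (hτ4 : (A.trace) ^ 2 < 4 * A.det)
    (h1 : (A.trace) ^ 2 ≠ A.det) (h2 : (A.trace) ^ 2 ≠ 2 * A.det)
    (h3 : (A.trace) ^ 2 ≠ 3 * A.det) :
    Irrational (Real.arccos ((A.trace : ℝ) / (2 * Real.sqrt (A.det : ℝ))) / Real.pi) := by
  rintro ⟨q, hq⟩
  set θ := Real.arccos ((A.trace : ℝ) / (2 * Real.sqrt (A.det : ℝ))) with hθ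
  have hD : (0 : ℝ) < A.det := by exact_mod_cast hΔ
  have hD0 : (A.det : ℝ) ≠ 0 := hD.ne'
  have h0 : (0 : ℝ) < (A.trace : ℝ) ^ 2 := by exact_mod_cast hτ0
  have h4 : (A.trace : ℝ) ^ 2 < 4 * A.det := by exact_mod_cast hτ4
  have hsq : ((A.trace : ℝ) / (2 * Real.sqrt (A.det : ℝ))) ^ 2 =
      (A.trace : ℝ) ^ 2 / (4 * A.det) := by
    rw [div_pow, mul_pow, Real.sq_sqrt hD.le]
    norm_num
  have habs := abs_le.mp <| (sq_le_one_iff_abs_le_one _).mp <|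
    hsq.trans_le <| (div_le_one (by positivity)).mpr h4.le
  have hcos : Real.cos (2 * θ) = (A.trace : ℝ) ^ 2 / (2 * A.det) - 1 := by
    rw [Real.cos_two_mul, hθ, Real.cos_arccos habs.1 habs.2, hsq]
    field_simp
    ring
  have hangle : ∃ r : ℚ, 2 * θ = r * Real.pi := by
    refine ⟨2 * q, ?_⟩
    push_cast
    rw [hq]
    field_simp
  have hrat : ∃ r : ℚ, Real.cos (2 * θ) = r :=
    ⟨(A.trace : ℚ) ^ 2 / (2 * A.det) - 1, by rw [hcos]; push_cast; rfl⟩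
  have hval := niven hangle hrat
  rw [hcos] at hval
  simp only [Set.mem_insert_iff, Set.mem_singleton_iff] at hval
  rcases hval with h | h | h | h | h <;> field_simp at h
  · linarith
  · exact h1 (by exact_mod_cast (by linarith : (A.trace : ℝ) ^ 2 = A.det))
  · exact h2 (by exact_mod_cast (by linarith : (A.trace : ℝ) ^ 2 = 2 * A.det))
  · exact h3 (by exact_mod_cast (by linarith : (A.trace : ℝ) ^ 2 = 3 * A.det))
  · linarith
end

section
/- The number arccos(√2/4)/π is irrational. -/
/-- The number `arccos(√2/4)/π` is irrational. -/
theorem arccos_sqrt_two_div_four_div_pi_irrational :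
    Irrational (Real.arccos (Real.sqrt 2 / 4) / Real.pi) := by
  rintro ⟨r, hr⟩
  have hsq : Real.sqrt 2 ^ 2 = 2 := Real.sq_sqrt zero_le_two
  have hcos : Real.cos (2 * Real.arccos (Real.sqrt 2 / 4)) = -3 / 4 := by
    rw [Real.cos_two_mul, Real.cos_arccos (by linarith [Real.sqrt_nonneg 2]) (by nlinarith),
      div_pow, hsq]
    norm_num
  have hangle : 2 * Real.arccos (Real.sqrt 2 / 4) = (2 * r : ℚ) * Real.pi := by
    rw [eq_div_iff Real.pi_ne_zero] at hr
    push_cast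
    linarith
  have hniven := niven ⟨_, hangle⟩ ⟨-3 / 4, by rw [hcos]; norm_num⟩
  rw [hcos] at hniven
  norm_num at hniven
end
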